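/- arXiv:2301.04588 — 7 statements merged into one kernel-verified Lean document; each statement's English description precedes it below -/
import Mathlib

section
/- Let ρ > 0, t, α₊ ∈ ℝ, let ξ ∈ ℝ with |ξ| > ρ, and let p ∈ ℝ satisfy p² = ξ² − ρ² and p ≠ 0. Define E⁺(x) = [[1, −i(ξ−p)ρ⁻¹ e^{−iα₊+2iρ²t}],[i(ξ−p)ρ⁻¹ e^{iα₊−2iρ²t}, 1]] · diag(e^{−ipx}, e^{ipx}). If M : ℝ → M₂(ℂ) is differentiable, satisfies M'(x) = Q(x)M(x) with Q(x) = [[−iξ, u(x)*],[u(x), iξ]] for a continuous u : ℝ → ℂ, and M(x)·E⁺(x)⁻¹ → I as x → +∞, then det M(x) = 2p(ξ−p)/ρ² for every x ∈ ℝ. -/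
open Complex Matrix Filter

/-- **Liouville's formula** for a traceless linear `2 × 2` system: the determinant of a matrix
solution is constant. -/
theorem det_eq_det_of_hasDerivAt_of_trace_eq_zero {A M : ℝ → Matrix (Fin 2) (Fin 2) ℂ}
    (hA : ∀ x, (A x).trace = 0)
    (hM : ∀ x i j, HasDerivAt (fun y => M y i j) ((A x * M x) i j) x) (x y : ℝ) :
    (M x).det = (M y).det := by
  have hdet : ∀ z, HasDerivAt (fun w => (M w).det) 0 z := by
    intro z
    have h := ((hM z 0 0).mul (hM z 1 1)).sub ((hM z 0 1).mul (hM z 1 0))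
    simp only [Matrix.det_fin_two]
    refine h.congr_deriv ?_
    have htr := hA z
    simp only [Matrix.trace_fin_two] at htr
    simp only [Matrix.mul_apply, Fin.sum_univ_two]
    linear_combination (M z 0 0 * M z 1 1 - M z 0 1 * M z 1 0) * htr
  exact is_const_of_deriv_eq_zero (fun z => (hdet z).differentiableAt)
    (fun z => (hdet z).deriv) x y

/-- If `M` solves the Zakharov–Shabat system `M' = Q M` (with real spectral parameter
`ξ`, `|ξ| > ρ`, `p² = ξ² − ρ²`, `p ≠ 0`) and `M(x) E⁺(x)⁻¹ → I` as `x → +∞`, where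
`E⁺` is the free asymptotic matrix solution, then `det (M x) = 2p(ξ−p)/ρ²` for all `x`. -/
theorem det_eq_of_jost_asymptotics
    (ρ t αp : ℝ) (hρ : 0 < ρ) (ξ p : ℝ) (hξ : ρ < |ξ|)
    (hp : p ^ 2 = ξ ^ 2 - ρ ^ 2) (hp0 : p ≠ 0)
    (u : ℝ → ℂ) (hu : Continuous u)
    (Eplus : ℝ → Matrix (Fin 2) (Fin 2) ℂ)
    (hE : ∀ x : ℝ, Eplus x =
      !![1, -Complex.I * ((ξ : ℂ) - p) * (ρ : ℂ)⁻¹ *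
            Complex.exp (-Complex.I * αp + 2 * Complex.I * ρ ^ 2 * t);
         Complex.I * ((ξ : ℂ) - p) * (ρ : ℂ)⁻¹ *
            Complex.exp (Complex.I * αp - 2 * Complex.I * ρ ^ 2 * t), 1] *
      !![Complex.exp (-Complex.I * p * x), 0; 0, Complex.exp (Complex.I * p * x)])
    (M : ℝ → Matrix (Fin 2) (Fin 2) ℂ)
    (hM : ∀ x i j, HasDerivAt (fun y => M y i j)
      ((!![-(Complex.I * ξ), star (u x); u x, Complex.I * ξ] * M x) i j) x)
    (hlim : Tendsto (fun x => M x * (Eplus x)⁻¹) atTop (nhds 1)) :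
    ∀ x, (M x).det = 2 * p * ((ξ : ℂ) - p) / (ρ : ℂ) ^ 2 := by
  have hρ0 : (ρ : ℂ) ≠ 0 := by exact_mod_cast hρ.ne'
  have hpC : (p : ℂ) ^ 2 = (ξ : ℂ) ^ 2 - (ρ : ℂ) ^ 2 := by exact_mod_cast hp
  have hξp : (ξ : ℂ) - p ≠ 0 := by
    intro h
    apply hρ0
    apply (pow_eq_zero_iff two_ne_zero).mp
    linear_combination ((ξ : ℂ) + p) * h + hpC
  set d : ℂ := 2 * p * ((ξ : ℂ) - p) / (ρ : ℂ) ^ 2 with hd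
  have hd0 : d ≠ 0 := by
    have hp0' : (p : ℂ) ≠ 0 := by exact_mod_cast hp0
    exact div_ne_zero (mul_ne_zero (mul_ne_zero two_ne_zero hp0') hξp) (pow_ne_zero 2 hρ0)
  have hdetE : ∀ x, (Eplus x).det = d := by
    intro x
    have hphase : Complex.exp (-Complex.I * αp + 2 * Complex.I * ρ ^ 2 * t) *
        Complex.exp (Complex.I * αp - 2 * Complex.I * ρ ^ 2 * t) = 1 := by
      rw [← Complex.exp_add, ← Complex.exp_zero]
      congr 1
      ring
    have hplane : Complex.exp (-Complex.I * p * x) * Complex.exp (Complex.I * p * x) = 1 := by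
      rw [← Complex.exp_add, ← Complex.exp_zero]
      congr 1
      ring
    have hscalar : 1 - ((ξ : ℂ) - p) ^ 2 * (ρ : ℂ)⁻¹ ^ 2 = d := by
      rw [hd]
      field_simp
      linear_combination hpC
    rw [hE, Matrix.det_mul, Matrix.det_fin_two_of, Matrix.det_fin_two_of, ← hscalar]
    simp only [mul_zero, sub_zero, hplane, mul_one]
    linear_combination (Complex.I ^ 2 * ((ξ : ℂ) - p) ^ 2 * (ρ : ℂ)⁻¹ ^ 2) * hphase +
      (((ξ : ℂ) - p) ^ 2 * (ρ : ℂ)⁻¹ ^ 2) * Complex.I_sq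
  intro x
  have hconst : ∀ y, (M y).det = (M x).det := fun y =>
    det_eq_det_of_hasDerivAt_of_trace_eq_zero
      (A := fun z => !![-(Complex.I * ξ), star (u z); u z, Complex.I * ξ])
      (fun z => by simp [Matrix.trace_fin_two]) hM y x
  have hlimdet : Tendsto (fun y => (M y * (Eplus y)⁻¹).det) atTop (nhds 1) := by
    have hcont : Continuous fun N : Matrix (Fin 2) (Fin 2) ℂ => N.det := continuous_id.matrix_det
    simpa only [Matrix.det_one, Function.comp_def] using (hcont.tendsto 1).comp hlim
  simp only [Matrix.det_mul, Matrix.det_nonsing_inv, Ring.inverse_eq_inv', hdetE, hconst]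
    at hlimdet
  have h1 : (M x).det * d⁻¹ = 1 := tendsto_nhds_unique tendsto_const_nhds hlimdet
  exact (mul_inv_eq_one₀ hd0).mp h1
end

section
/- Let N ∈ ℕ, ξ ∈ ℝ, ξ₁,…,ξ_N ∈ ℝ, and let u : ℝ×ℝ → ℂ be smooth. For n = 1,…,N let Fₙ = (f₁ₙ, f₂ₙ) and Gₙ = (g₁ₙ, g₂ₙ) : ℝ×ℝ → ℂ² be smooth such that for each t, Fₙ(·,t) solves the Zakharov–Shabat system at ξₙ and Gₙ(·,t) solves the adjoint system at ξₙ (all in the x-variable). For n = 1,…,N set F_{N+n} = (f₂ₙ*, f₁ₙ*), G_{N+n} = (g₂ₙ*, g₁ₙ*), ξ_{N+n} = ξₙ. Assume u satisfies the NLS equation with self-consistent source: i u_t − 2u|u|² + u_xx = −2i Σ_{n=1}^{N} (f₁ₙ* g₂ₙ* + f₂ₙ g₁ₙ). Let f = (p₁, p₂) : ℝ×ℝ → ℂ² be smooth with f(·,t) solving the Zakharov–Shabat system at ξ, and let φ₁,…,φ_{2N} : ℝ×ℝ → ℂ be smooth and satisfy ∂φₙ/∂x = g₁ₙ p₁ +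 g₂ₙ p₂ and (g₁ₙ p₁ − g₂ₙ p₂) + i(ξ − ξₙ)φₙ = 0 for all (x,t). Define the matrix A(x,t) = [[i|u|² + 2iξ², −i u_x* − 2ξ u*],[i u_x − 2ξ u, −i|u|² − 2iξ²]] and H = ∂f/∂t − A f + Σ_{n=1}^{2N} Fₙ φₙ. Then for each t, H(·,t) solves the Zakharov–Shabat system at ξ, i.e. H₁' = −iξ H₁ + u* H₂ and H₂' = iξ H₂ + u H₁. -/
open Complex

section PartialDerivatives

variable {E : Type*} [NormedAddCommGroup E] [NormedSpace ℝ E] {p : ℝ → ℝ → E}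

theorem ContDiff.hasDerivAt_partial_fst
    (hp : ContDiff ℝ (⊤ : ℕ∞) (fun q : ℝ × ℝ => p q.1 q.2)) (x t : ℝ) :
    HasDerivAt (fun y => p y t) (fderiv ℝ (fun q : ℝ × ℝ => p q.1 q.2) (x, t) (1, 0)) x := by
  have hd : HasFDerivAt (fun q : ℝ × ℝ => p q.1 q.2) _ (x, t) :=
    (hp.differentiable (by simp) (x, t)).hasFDerivAt
  exact hd.comp_hasDerivAt (f := fun y : ℝ => (y, t)) x
    ((hasDerivAt_id x).prodMk (hasDerivAt_const x t))

theorem ContDiff.hasDerivAt_partial_snd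
    (hp : ContDiff ℝ (⊤ : ℕ∞) (fun q : ℝ × ℝ => p q.1 q.2)) (x t : ℝ) :
    HasDerivAt (fun s => p x s) (fderiv ℝ (fun q : ℝ × ℝ => p q.1 q.2) (x, t) (0, 1)) t := by
  have hd : HasFDerivAt (fun q : ℝ × ℝ => p q.1 q.2) _ (x, t) :=
    (hp.differentiable (by simp) (x, t)).hasFDerivAt
  exact hd.comp_hasDerivAt (f := fun s : ℝ => (x, s)) t
    ((hasDerivAt_const t x).prodMk (hasDerivAt_id t))

theorem ContDiff.partial_fst
    (hp : ContDiff ℝ (⊤ : ℕ∞) (fun q : ℝ × ℝ => p q.1 q.2)) :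
    ContDiff ℝ (⊤ : ℕ∞) (fun q : ℝ × ℝ => deriv (fun y => p y q.2) q.1) := by
  have h : (fun q : ℝ × ℝ => deriv (fun y => p y q.2) q.1) =
      fun q => fderiv ℝ (fun q : ℝ × ℝ => p q.1 q.2) q (1, 0) :=
    funext fun q => (hp.hasDerivAt_partial_fst q.1 q.2).deriv
  rw [h]
  exact (hp.fderiv_right (by simp)).clm_apply contDiff_const

/-- Mixed partial derivatives commute. -/
theorem ContDiff.hasDerivAt_partial_snd_partial_fst
    (hp : ContDiff ℝ (⊤ : ℕ∞) (fun q : ℝ × ℝ => p q.1 q.2)) (x t : ℝ) :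
    HasDerivAt (fun y => deriv (fun s => p y s) t)
      (deriv (fun s => deriv (fun y => p y s) x) t) x := by
  set D := fderiv ℝ (fun q : ℝ × ℝ => p q.1 q.2) with hD
  have hD' : DifferentiableAt ℝ D (x, t) :=
    (hp.fderiv_right (m := 1) (WithTop.coe_le_coe.2 (le_top : (1 + 1 : ℕ∞) ≤ ⊤))).differentiable (by simp) _
  have hsymm : fderiv ℝ D (x, t) (1, 0) (0, 1) = fderiv ℝ D (x, t) (0, 1) (1, 0) :=
    hp.contDiffAt.isSymmSndFDerivAt
      (by simpa using WithTop.coe_le_coe.2 (le_top : (2 : ℕ∞) ≤ ⊤)) _ _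
  have h1 : HasDerivAt (fun y => D (y, t) (0, 1)) (fderiv ℝ D (x, t) (1, 0) (0, 1)) x := by
    have := hD'.hasFDerivAt.comp_hasDerivAt (f := fun y : ℝ => (y, t)) x
      ((hasDerivAt_id x).prodMk (hasDerivAt_const x t))
    simpa using this.clm_apply (hasDerivAt_const x ((0 : ℝ), (1 : ℝ)))
  have h2 : HasDerivAt (fun s => D (x, s) (1, 0)) (fderiv ℝ D (x, t) (0, 1) (1, 0)) t := by
    have := hD'.hasFDerivAt.comp_hasDerivAt (f := fun s : ℝ => (x, s)) t
      ((hasDerivAt_const t x).prodMk (hasDerivAt_id t))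
    simpa using this.clm_apply (hasDerivAt_const t ((1 : ℝ), (0 : ℝ)))
  have e1 : (fun y => deriv (fun s => p y s) t) = fun y => D (y, t) (0, 1) :=
    funext fun y => (hp.hasDerivAt_partial_snd y t).deriv
  have e2 : (fun s => deriv (fun y => p y s) x) = fun s => D (x, s) (1, 0) :=
    funext fun s => (hp.hasDerivAt_partial_fst x s).deriv
  rw [e1, e2, h2.deriv, ← hsymm]
  exact h1

theorem ContDiff.hasDerivAt_fst
    (hp : ContDiff ℝ (⊤ : ℕ∞) (fun q : ℝ × ℝ => p q.1 q.2)) (x t : ℝ) :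
    HasDerivAt (fun y => p y t) (deriv (fun y => p y t) x) x :=
  (hp.hasDerivAt_partial_fst x t).differentiableAt.hasDerivAt

theorem ContDiff.hasDerivAt_snd
    (hp : ContDiff ℝ (⊤ : ℕ∞) (fun q : ℝ × ℝ => p q.1 q.2)) (x t : ℝ) :
    HasDerivAt (fun s => p x s) (deriv (fun s => p x s) t) t :=
  (hp.hasDerivAt_partial_snd x t).differentiableAt.hasDerivAt

end PartialDerivatives

/-- Second assertion of the paper's Lemma. Let `u` solve the NLS equation with a
self-consistent source built from eigenfunctions `Fₙ = (f1 n, f2 n)` of the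
Zakharov–Shabat system at `ξₙ` and solutions `Gₙ = (g1 n, g2 n)` of the adjoint
system at `ξₙ`, extended by `F_{N+n} = (f2ₙ*, f1ₙ*)`, `G_{N+n} = (g2ₙ*, g1ₙ*)`,
`ξ_{N+n} = ξₙ`. If `f = (p1,p2)` solves the Zakharov–Shabat system at `ξ` and the
functions `φₙ` satisfy `∂φₙ/∂x = Gₙᵀ f` and `Gₙᵀσ₃f + i(ξ-ξₙ)φₙ = 0`, then
`H = f_t - A f + Σₙ Fₙ φₙ` again solves the Zakharov–Shabat system at `ξ`. -/
theorem H_solves_spectral_problem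
    (N : ℕ) (ξ : ℝ) (ξs : Fin N → ℝ)
    (u : ℝ → ℝ → ℂ) (hu : ContDiff ℝ (⊤ : ℕ∞) (fun q : ℝ × ℝ => u q.1 q.2))
    (f1 f2 g1 g2 : Fin N → ℝ → ℝ → ℂ)
    (hf1 : ∀ n, ContDiff ℝ (⊤ : ℕ∞) (fun q : ℝ × ℝ => f1 n q.1 q.2))
    (hf2 : ∀ n, ContDiff ℝ (⊤ : ℕ∞) (fun q : ℝ × ℝ => f2 n q.1 q.2))
    (hg1 : ∀ n, ContDiff ℝ (⊤ : ℕ∞) (fun q : ℝ × ℝ => g1 n q.1 q.2))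
    (hg2 : ∀ n, ContDiff ℝ (⊤ : ℕ∞) (fun q : ℝ × ℝ => g2 n q.1 q.2))
    -- Fₙ solves the Zakharov–Shabat system at ξₙ
    (hZSf1 : ∀ n x t, deriv (fun y => f1 n y t) x =
      -(Complex.I * (ξs n : ℂ)) * f1 n x t + star (u x t) * f2 n x t)
    (hZSf2 : ∀ n x t, deriv (fun y => f2 n y t) x =
      Complex.I * (ξs n : ℂ) * f2 n x t + u x t * f1 n x t)
    -- Gₙ solves the adjoint system at ξₙ
    (hAdjg1 : ∀ n x t, deriv (fun y => g1 n y t) x =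
      Complex.I * (ξs n : ℂ) * g1 n x t + u x t * g2 n x t)
    (hAdjg2 : ∀ n x t, deriv (fun y => g2 n y t) x =
      -(Complex.I * (ξs n : ℂ)) * g2 n x t + star (u x t) * g1 n x t)
    -- u solves the NLS equation with self-consistent source
    (hNLS : ∀ x t, Complex.I * deriv (fun s => u x s) t
        - 2 * u x t * (u x t * star (u x t))
        + deriv (fun y => deriv (fun z => u z t) y) x =
      -2 * Complex.I * ∑ n, (star (f1 n x t) * star (g2 n x t) + f2 n x t * g1 n x t))
    -- f = (p1, p2) solves the Zakharov–Shabat system at ξ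
    (p1 p2 : ℝ → ℝ → ℂ)
    (hp1 : ContDiff ℝ (⊤ : ℕ∞) (fun q : ℝ × ℝ => p1 q.1 q.2))
    (hp2 : ContDiff ℝ (⊤ : ℕ∞) (fun q : ℝ × ℝ => p2 q.1 q.2))
    (hZSp1 : ∀ x t, deriv (fun y => p1 y t) x =
      -(Complex.I * (ξ : ℂ)) * p1 x t + star (u x t) * p2 x t)
    (hZSp2 : ∀ x t, deriv (fun y => p2 y t) x =
      Complex.I * (ξ : ℂ) * p2 x t + u x t * p1 x t)
    -- the functions φₙ, n = 1, …, 2N (φB n plays the role of φ_{N+n})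
    (φA φB : Fin N → ℝ → ℝ → ℂ)
    (hφA : ∀ n, ContDiff ℝ (⊤ : ℕ∞) (fun q : ℝ × ℝ => φA n q.1 q.2))
    (hφB : ∀ n, ContDiff ℝ (⊤ : ℕ∞) (fun q : ℝ × ℝ => φB n q.1 q.2))
    (hφAx : ∀ n x t, deriv (fun y => φA n y t) x =
      g1 n x t * p1 x t + g2 n x t * p2 x t)
    (hφBx : ∀ n x t, deriv (fun y => φB n y t) x =
      star (g2 n x t) * p1 x t + star (g1 n x t) * p2 x t)
    (hφArel : ∀ n x t,
      (g1 n x t * p1 x t - g2 n x t * p2 x t)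
        + Complex.I * ((ξ : ℂ) - (ξs n : ℂ)) * φA n x t = 0)
    (hφBrel : ∀ n x t,
      (star (g2 n x t) * p1 x t - star (g1 n x t) * p2 x t)
        + Complex.I * ((ξ : ℂ) - (ξs n : ℂ)) * φB n x t = 0)
    -- H = f_t - A f + Σ_{n=1}^{2N} Fₙ φₙ
    (H1 H2 : ℝ → ℝ → ℂ)
    (hH1 : ∀ x t, H1 x t = deriv (fun s => p1 x s) t
      - ((Complex.I * (u x t * star (u x t)) + 2 * Complex.I * (ξ : ℂ) ^ 2) * p1 x t
        + (-(Complex.I * star (deriv (fun y => u y t) x)) - 2 * (ξ : ℂ) * star (u x t)) * p2 x t)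
      + ∑ n, (f1 n x t * φA n x t + star (f2 n x t) * φB n x t))
    (hH2 : ∀ x t, H2 x t = deriv (fun s => p2 x s) t
      - ((Complex.I * deriv (fun y => u y t) x - 2 * (ξ : ℂ) * u x t) * p1 x t
        + (-(Complex.I * (u x t * star (u x t))) - 2 * Complex.I * (ξ : ℂ) ^ 2) * p2 x t)
      + ∑ n, (f2 n x t * φA n x t + star (f1 n x t) * φB n x t)) :
    ∀ x t, HasDerivAt (fun y => H1 y t)
        (-(Complex.I * (ξ : ℂ)) * H1 x t + star (u x t) * H2 x t) x ∧
      HasDerivAt (fun y => H2 y t)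
        (Complex.I * (ξ : ℂ) * H2 x t + u x t * H1 x t) x := by
  intro x t
  have hux := hu.hasDerivAt_fst x t
  have hut := hu.hasDerivAt_snd x t
  have huxx := hu.partial_fst.hasDerivAt_fst (p := fun x t => deriv (fun y => u y t) x) x t
  have hp1x := hp1.hasDerivAt_fst x t
  have hp2x := hp2.hasDerivAt_fst x t
  have hp1t := hp1.hasDerivAt_snd x t
  have hp2t := hp2.hasDerivAt_snd x t
  have hp1tx := hp1.hasDerivAt_partial_snd_partial_fst x t
  have hp2tx := hp2.hasDerivAt_partial_snd_partial_fst x t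
  have e1 : deriv (fun s => deriv (fun y => p1 y s) x) t =
      -(I * (ξ : ℂ)) * deriv (fun s => p1 x s) t
        + (star (deriv (fun s => u x s) t) * p2 x t
          + star (u x t) * deriv (fun s => p2 x s) t) := by
    simp only [hZSp1]
    exact ((hp1t.const_mul _).add (hut.star.mul hp2t)).deriv
  have e2 : deriv (fun s => deriv (fun y => p2 y s) x) t =
      I * (ξ : ℂ) * deriv (fun s => p2 x s) t
        + (deriv (fun s => u x s) t * p1 x t
          + u x t * deriv (fun s => p1 x s) t) := by
    simp only [hZSp2]
    exact ((hp2t.const_mul _).add (hut.mul hp1t)).deriv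
  rw [e1] at hp1tx
  rw [e2] at hp2tx
  rw [hZSp1] at hp1x
  rw [hZSp2] at hp2x
  have hS1 : HasDerivAt
      (fun y => ∑ n, (f1 n y t * φA n y t + star (f2 n y t) * φB n y t))
      (-(I * (ξ : ℂ)) * ∑ n, (f1 n x t * φA n x t + star (f2 n x t) * φB n x t)
        + star (u x t) * ∑ n, (f2 n x t * φA n x t + star (f1 n x t) * φB n x t)
        + 2 * p2 x t * ∑ n, (f1 n x t * g2 n x t + star (f2 n x t) * star (g1 n x t))) x := by
    have h := HasDerivAt.fun_sum (u := Finset.univ) fun n _ =>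
      (((hf1 n).hasDerivAt_fst x t).mul ((hφA n).hasDerivAt_fst x t)).add
        (((hf2 n).hasDerivAt_fst x t).star.mul ((hφB n).hasDerivAt_fst x t))
    refine h.congr_deriv ?_
    simp only [Finset.mul_sum, ← Finset.sum_add_distrib]
    refine Finset.sum_congr rfl fun n _ => ?_
    rw [hZSf1, hZSf2, hφAx, hφBx]
    simp only [star_add, star_mul', star_def, conj_I, conj_ofReal]
    have hA := hφArel n x t
    have hB := hφBrel n x t
    simp only [star_def] at hB
    linear_combination f1 n x t * hA + (starRingEnd ℂ) (f2 n x t) * hB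
  have hS2 : HasDerivAt
      (fun y => ∑ n, (f2 n y t * φA n y t + star (f1 n y t) * φB n y t))
      (I * (ξ : ℂ) * ∑ n, (f2 n x t * φA n x t + star (f1 n x t) * φB n x t)
        + u x t * ∑ n, (f1 n x t * φA n x t + star (f2 n x t) * φB n x t)
        + 2 * p1 x t * ∑ n, (star (f1 n x t) * star (g2 n x t) + f2 n x t * g1 n x t)) x := by
    have h := HasDerivAt.fun_sum (u := Finset.univ) fun n _ =>
      (((hf2 n).hasDerivAt_fst x t).mul ((hφA n).hasDerivAt_fst x t)).add
        (((hf1 n).hasDerivAt_fst x t).star.mul ((hφB n).hasDerivAt_fst x t))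
    refine h.congr_deriv ?_
    simp only [Finset.mul_sum, ← Finset.sum_add_distrib]
    refine Finset.sum_congr rfl fun n _ => ?_
    rw [hZSf1, hZSf2, hφAx, hφBx]
    simp only [star_add, star_neg, star_mul', star_def, conj_I, conj_ofReal, conj_conj]
    have hA := hφArel n x t
    have hB := hφBrel n x t
    simp only [star_def] at hB
    linear_combination -(f2 n x t) * hA - (starRingEnd ℂ) (f1 n x t) * hB
  have hN := hNLS x t
  have hN' := congrArg star hN
  simp only [star_add, star_sub, star_neg, star_mul', star_sum, star_ofNat,
    star_def, conj_I, conj_conj] at hN'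
  constructor
  · have h := (hp1tx.sub (((((hux.mul hux.star).const_mul I).add_const
      (2 * I * (ξ : ℂ) ^ 2)).mul hp1x).add
        (((huxx.star.const_mul I).neg.sub (hux.star.const_mul (2 * (ξ : ℂ)))).mul hp2x))).add hS1
    have hfun : (fun y => H1 y t) = _ := funext fun y => hH1 y t
    rw [hfun]
    refine h.congr_deriv ?_
    rw [hH1, hH2]
    simp only [star_def, Pi.mul_apply, Pi.neg_apply, Pi.sub_apply] at hN' ⊢
    linear_combination I * p2 x t * hN' + p2 x t *
      (2 * (ξ : ℂ) * (starRingEnd ℂ) (deriv (fun y => u y t) x)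
      + (starRingEnd ℂ) (deriv (fun s => u x s) t)
      + 2 * ∑ n, (f1 n x t * g2 n x t
        + (starRingEnd ℂ) (f2 n x t) * (starRingEnd ℂ) (g1 n x t))) * I_sq
  · have h := (hp2tx.sub ((((huxx.const_mul I).sub (hux.const_mul (2 * (ξ : ℂ)))).mul hp1x).add
        ((((hux.mul hux.star).const_mul I).neg.sub_const (2 * I * (ξ : ℂ) ^ 2)).mul hp2x))).add hS2
    have hfun : (fun y => H2 y t) = _ := funext fun y => hH2 y t
    rw [hfun]
    refine h.congr_deriv ?_
    rw [hH1, hH2]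
    simp only [star_def, Pi.mul_apply, Pi.neg_apply, Pi.sub_apply] at hN ⊢
    linear_combination -I * p1 x t * hN + p1 x t *
      (2 * (ξ : ℂ) * deriv (fun y => u y t) x
      + deriv (fun s => u x s) t
      + 2 * ∑ n, ((starRingEnd ℂ) (f1 n x t) * (starRingEnd ℂ) (g2 n x t)
        + f2 n x t * g1 n x t)) * I_sq
end

section
/- Let ρ > 0, t, α₊ ∈ ℝ, ξ ∈ (−ρ, ρ), and set p = i√(ρ² − ξ²) (so p² = ξ² − ρ² and p ≠ 0). Let c ∈ ℂ and let u : ℝ → ℂ be continuous. Suppose v, w : ℝ → ℂ² are differentiable solutions of the Zakharov–Shabat system at ξ with potential u, and that lim_{x→+∞} v(x) e^{−ipx} = c·(−i(ξ−p)ρ⁻¹ e^{−iα₊+2iρ²t}, 1)ᵀ and lim_{x→+∞} w(x) e^{ipx} = (1, i(ξ−p)ρ⁻¹ e^{iα₊−2iρ²t})ᵀ. Then for every x ∈ ℝ, det(v(x), w(x)) = −2p(ξ−p)c/ρ², where det(v,w) = v₁w₂ − v₂w₁. -/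
open Complex Filter

/-- The Wronskian of two differentiable solutions of the Zakharov–Shabat system is constant. -/
theorem zakharovShabat_wronskian_const {ξ : ℂ} {u v1 v2 w1 w2 : ℝ → ℂ}
    (hv1 : ∀ x, HasDerivAt v1 (-(Complex.I * ξ) * v1 x + star (u x) * v2 x) x)
    (hv2 : ∀ x, HasDerivAt v2 (Complex.I * ξ * v2 x + u x * v1 x) x)
    (hw1 : ∀ x, HasDerivAt w1 (-(Complex.I * ξ) * w1 x + star (u x) * w2 x) x)
    (hw2 : ∀ x, HasDerivAt w2 (Complex.I * ξ * w2 x + u x * w1 x) x) (x y : ℝ) :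
    v1 x * w2 x - v2 x * w1 x = v1 y * w2 y - v2 y * w1 y := by
  have hderiv : ∀ z, HasDerivAt (fun z => v1 z * w2 z - v2 z * w1 z) 0 z := fun z =>
    (((hv1 z).mul (hw2 z)).sub ((hv2 z).mul (hw1 z))).congr_deriv (by ring)
  exact is_const_of_deriv_eq_zero (fun z => (hderiv z).differentiableAt)
    (fun z => (hderiv z).deriv) x y

/-- Evaluation of the Wronskian `det(φₙ, hₙ)`: if `v`, `w` solve the Zakharov–Shabat
system at `ξ ∈ (-ρ,ρ)` with `p = i√(ρ²-ξ²)`, `v(x)e^{-ipx} → c·(-i(ξ-p)ρ⁻¹e^{-iα₊+2iρ²t}, 1)ᵀ`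
and `w(x)e^{ipx} → (1, i(ξ-p)ρ⁻¹e^{iα₊-2iρ²t})ᵀ` as `x → +∞`, then
`det(v(x), w(x)) = -2p(ξ-p)c/ρ²` for every `x`. -/
theorem wronskian_eigenfunction_associated
    (ρ t αp ξ : ℝ) (hρ : 0 < ρ) (hξ : ξ ∈ Set.Ioo (-ρ) ρ)
    (p : ℂ) (hp : p = Complex.I * (Real.sqrt (ρ ^ 2 - ξ ^ 2) : ℂ))
    (c : ℂ) (u : ℝ → ℂ) (hu : Continuous u)
    (v1 v2 w1 w2 : ℝ → ℂ)
    (hv1 : ∀ x, HasDerivAt v1 (-(Complex.I * (ξ : ℂ)) * v1 x + star (u x) * v2 x) x)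
    (hv2 : ∀ x, HasDerivAt v2 (Complex.I * (ξ : ℂ) * v2 x + u x * v1 x) x)
    (hw1 : ∀ x, HasDerivAt w1 (-(Complex.I * (ξ : ℂ)) * w1 x + star (u x) * w2 x) x)
    (hw2 : ∀ x, HasDerivAt w2 (Complex.I * (ξ : ℂ) * w2 x + u x * w1 x) x)
    (hvlim1 : Tendsto (fun x : ℝ => v1 x * Complex.exp (-(Complex.I * p * x))) atTop
      (nhds (c * (-(Complex.I * ((ξ : ℂ) - p)) * (ρ : ℂ)⁻¹ *
        Complex.exp (-(Complex.I * αp) + 2 * Complex.I * ρ ^ 2 * t)))))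
    (hvlim2 : Tendsto (fun x : ℝ => v2 x * Complex.exp (-(Complex.I * p * x))) atTop (nhds c))
    (hwlim1 : Tendsto (fun x : ℝ => w1 x * Complex.exp (Complex.I * p * x)) atTop (nhds 1))
    (hwlim2 : Tendsto (fun x : ℝ => w2 x * Complex.exp (Complex.I * p * x)) atTop
      (nhds (Complex.I * ((ξ : ℂ) - p) * (ρ : ℂ)⁻¹ *
        Complex.exp (Complex.I * αp - 2 * Complex.I * ρ ^ 2 * t)))) :
    ∀ x, v1 x * w2 x - v2 x * w1 x = -(2 * p * ((ξ : ℂ) - p) * c) / (ρ : ℂ) ^ 2 := by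
  intro x
  have hρ0 : (ρ : ℂ) ≠ 0 := Complex.ofReal_ne_zero.mpr hρ.ne'
  have hp2 : p ^ 2 = (ξ : ℂ) ^ 2 - (ρ : ℂ) ^ 2 := by
    have hnonneg : 0 ≤ ρ ^ 2 - ξ ^ 2 := by nlinarith [hξ.1, hξ.2]
    rw [hp, mul_pow, Complex.I_sq, ← Complex.ofReal_pow, Real.sq_sqrt hnonneg]
    push_cast
    ring
  have hexp : Complex.exp (-(Complex.I * αp) + 2 * Complex.I * ρ ^ 2 * t) *
      Complex.exp (Complex.I * αp - 2 * Complex.I * ρ ^ 2 * t) = 1 := by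
    rw [← Complex.exp_add, ← Complex.exp_zero]
    congr 1
    ring
  have hlim := (hvlim1.mul hwlim2).sub (hvlim2.mul hwlim1)
  have hconst : Tendsto (fun _ : ℝ => v1 x * w2 x - v2 x * w1 x) atTop
      (nhds (v1 x * w2 x - v2 x * w1 x)) := tendsto_const_nhds
  refine (tendsto_nhds_unique hconst (hlim.congr fun y => ?_)).trans ?_
  · have hcancel : Complex.exp (-(Complex.I * p * y)) * Complex.exp (Complex.I * p * y) = 1 := by
      rw [← Complex.exp_add, neg_add_cancel, Complex.exp_zero]
    rw [zakharovShabat_wronskian_const hv1 hv2 hw1 hw2 x y]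
    linear_combination (v1 y * w2 y - v2 y * w1 y) * hcancel
  · calc
      _ = -(Complex.I ^ 2) * c * ((ξ : ℂ) - p) ^ 2 / (ρ : ℂ) ^ 2 - c := by
        linear_combination (-(Complex.I ^ 2) * c * ((ξ : ℂ) - p) ^ 2 / (ρ : ℂ) ^ 2) * hexp
      _ = _ := by
        rw [Complex.I_sq]
        field_simp
        linear_combination (-c) * hp2
end

section
/- Let N ∈ ℕ, ξ ∈ ℝ, ξ₁,…,ξ_N ∈ ℝ, and let u : ℝ×ℝ → ℂ be smooth. For n = 1,…,N let Fₙ = (f₁ₙ,f₂ₙ), Gₙ = (g₁ₙ,g₂ₙ) : ℝ×ℝ → ℂ² be smooth with Fₙ(·,t) solving the Zakharov–Shabat system at ξₙ and Gₙ(·,t) solving the adjoint system at ξₙ for each t; set F_{N+n} = (f₂ₙ*, f₁ₙ*) and G_{N+n} = (g₂ₙ*, g₁ₙ*). Assume u satisfies i u_t − 2u|u|² + u_xx = −2i Σ_{n=1}^{N}(f₁ₙ* g₂ₙ* + f₂ₙ g₁ₙ). Then for every smooth f : ℝ×ℝ → ℂ² with f(·,t) solving the Zakharov–Shabat system at ξ,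 the pointwise identity (L_t f) + L(Af) − A(Lf) = i Σ_{n=1}^{2N} (σ₃ Fₙ Gₙᵀ − Fₙ Gₙᵀ σ₃) f holds, where L is the differential operator Lf = (i f₁_x − i u* f₂, i u f₁ − i f₂_x)ᵀ, L_t f = (−i u_t* f₂, i u_t f₁)ᵀ, A = [[i|u|² + 2iξ², −i u_x* − 2ξ u*],[i u_x − 2ξ u, −i|u|² − 2iξ²]], and σ₃ = diag(1,−1). -/
open Complex Matrix

/-- Slices in the first variable of a smooth function of two real variables are smooth. -/
theorem contDiff_slice_left {E : Type*} [NormedAddCommGroup E] [NormedSpace ℝ E]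
    {v : ℝ → ℝ → E} (hv : ContDiff ℝ (⊤ : ℕ∞) (fun q : ℝ × ℝ => v q.1 q.2)) (t : ℝ) :
    ContDiff ℝ (⊤ : ℕ∞) (fun y => v y t) :=
  hv.comp (contDiff_id.prodMk contDiff_const)

/-- The commutator of `σ₃ = diag(1, -1)` with a rank-one matrix is off-diagonal. -/
theorem sigma_three_commutator_vecMulVec {R : Type*} [CommRing R] (a b c d : R) :
    !![1, 0; 0, -1] * vecMulVec ![a, b] ![c, d] - vecMulVec ![a, b] ![c, d] * !![1, 0; 0, -1] =
      !![0, 2 * (a * d); -2 * (b * c), 0] := by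
  ext i j
  fin_cases i <;> fin_cases j <;>
    simp [-cons_mul, -vecMulVec_cons, -cons_vecMulVec, Matrix.mul_apply, Fin.sum_univ_two, vecMulVec_apply] <;>
    ring

/-- Lax-type operator identity `∂L/∂t + [L,A] = i Σ_{n=1}^{2N} [σ₃, FₙGₙᵀ]` for the
NLS equation with self-consistent source, valid on solutions `f = (p1,p2)` of the
spectral problem: pointwise,
`(L_t f) + L(Af) - A(Lf) = i Σ (σ₃FₙGₙᵀ - FₙGₙᵀσ₃) f`. -/
theorem lax_identity_nls_source
    (N : ℕ) (ξ : ℝ) (ξs : Fin N → ℝ)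
    (u : ℝ → ℝ → ℂ) (hu : ContDiff ℝ (⊤ : ℕ∞) (fun q : ℝ × ℝ => u q.1 q.2))
    (f1 f2 g1 g2 : Fin N → ℝ → ℝ → ℂ)
    (hf1 : ∀ n, ContDiff ℝ (⊤ : ℕ∞) (fun q : ℝ × ℝ => f1 n q.1 q.2))
    (hf2 : ∀ n, ContDiff ℝ (⊤ : ℕ∞) (fun q : ℝ × ℝ => f2 n q.1 q.2))
    (hg1 : ∀ n, ContDiff ℝ (⊤ : ℕ∞) (fun q : ℝ × ℝ => g1 n q.1 q.2))
    (hg2 : ∀ n, ContDiff ℝ (⊤ : ℕ∞) (fun q : ℝ × ℝ => g2 n q.1 q.2))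
    -- Fₙ solves the Zakharov–Shabat system at ξₙ, Gₙ solves the adjoint system at ξₙ
    (hZSf1 : ∀ n x t, deriv (fun y => f1 n y t) x =
      -(Complex.I * (ξs n : ℂ)) * f1 n x t + star (u x t) * f2 n x t)
    (hZSf2 : ∀ n x t, deriv (fun y => f2 n y t) x =
      Complex.I * (ξs n : ℂ) * f2 n x t + u x t * f1 n x t)
    (hAdjg1 : ∀ n x t, deriv (fun y => g1 n y t) x =
      Complex.I * (ξs n : ℂ) * g1 n x t + u x t * g2 n x t)
    (hAdjg2 : ∀ n x t, deriv (fun y => g2 n y t) x =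
      -(Complex.I * (ξs n : ℂ)) * g2 n x t + star (u x t) * g1 n x t)
    -- u solves the NLS equation with self-consistent source
    (hNLS : ∀ x t, Complex.I * deriv (fun s => u x s) t
        - 2 * u x t * (u x t * star (u x t))
        + deriv (fun y => deriv (fun z => u z t) y) x =
      -2 * Complex.I * ∑ n, (star (f1 n x t) * star (g2 n x t) + f2 n x t * g1 n x t))
    -- f = (p1, p2) solves the Zakharov–Shabat system at ξ
    (p1 p2 : ℝ → ℝ → ℂ)
    (hp1 : ContDiff ℝ (⊤ : ℕ∞) (fun q : ℝ × ℝ => p1 q.1 q.2))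
    (hp2 : ContDiff ℝ (⊤ : ℕ∞) (fun q : ℝ × ℝ => p2 q.1 q.2))
    (hZSp1 : ∀ x t, deriv (fun y => p1 y t) x =
      -(Complex.I * (ξ : ℂ)) * p1 x t + star (u x t) * p2 x t)
    (hZSp2 : ∀ x t, deriv (fun y => p2 y t) x =
      Complex.I * (ξ : ℂ) * p2 x t + u x t * p1 x t)
    -- Af = A·f and Lf = L f, componentwise
    (Af1 Af2 Lf1 Lf2 : ℝ → ℝ → ℂ)
    (hAf1 : ∀ x t, Af1 x t =
      (Complex.I * (u x t * star (u x t)) + 2 * Complex.I * (ξ : ℂ) ^ 2) * p1 x t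
      + (-(Complex.I * star (deriv (fun y => u y t) x)) - 2 * (ξ : ℂ) * star (u x t)) * p2 x t)
    (hAf2 : ∀ x t, Af2 x t =
      (Complex.I * deriv (fun y => u y t) x - 2 * (ξ : ℂ) * u x t) * p1 x t
      + (-(Complex.I * (u x t * star (u x t))) - 2 * Complex.I * (ξ : ℂ) ^ 2) * p2 x t)
    (hLf1 : ∀ x t, Lf1 x t =
      Complex.I * deriv (fun y => p1 y t) x - Complex.I * star (u x t) * p2 x t)
    (hLf2 : ∀ x t, Lf2 x t =
      Complex.I * u x t * p1 x t - Complex.I * deriv (fun y => p2 y t) x) :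
    -- (L_t f) + L(Af) - A(Lf) = i Σ_{n=1}^{2N} (σ₃FₙGₙᵀ - FₙGₙᵀσ₃) f
    ∀ x t,
      (![-(Complex.I * star (deriv (fun s => u x s) t)) * p2 x t
          + (Complex.I * deriv (fun y => Af1 y t) x - Complex.I * star (u x t) * Af2 x t)
          - ((Complex.I * (u x t * star (u x t)) + 2 * Complex.I * (ξ : ℂ) ^ 2) * Lf1 x t
            + (-(Complex.I * star (deriv (fun y => u y t) x)) - 2 * (ξ : ℂ) * star (u x t)) * Lf2 x t),
        Complex.I * deriv (fun s => u x s) t * p1 x t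
          + (Complex.I * u x t * Af1 x t - Complex.I * deriv (fun y => Af2 y t) x)
          - ((Complex.I * deriv (fun y => u y t) x - 2 * (ξ : ℂ) * u x t) * Lf1 x t
            + (-(Complex.I * (u x t * star (u x t))) - 2 * Complex.I * (ξ : ℂ) ^ 2) * Lf2 x t)]
        : Fin 2 → ℂ) =
      Matrix.mulVec
        (Complex.I • ∑ n,
          (((!![1, 0; 0, -1] : Matrix (Fin 2) (Fin 2) ℂ) *
              vecMulVec ![f1 n x t, f2 n x t] ![g1 n x t, g2 n x t]
            - vecMulVec ![f1 n x t, f2 n x t] ![g1 n x t, g2 n x t] * !![1, 0; 0, -1])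
          + ((!![1, 0; 0, -1] : Matrix (Fin 2) (Fin 2) ℂ) *
              vecMulVec ![star (f2 n x t), star (f1 n x t)] ![star (g2 n x t), star (g1 n x t)]
            - vecMulVec ![star (f2 n x t), star (f1 n x t)] ![star (g2 n x t), star (g1 n x t)]
              * !![1, 0; 0, -1])))
        ![p1 x t, p2 x t] := by
  intro x t
  have hu_slice := contDiff_slice_left hu t
  have hux_slice : ContDiff ℝ (⊤ : ℕ∞) (deriv (fun y => u y t)) :=
    (contDiff_infty_iff_deriv.1 hu_slice).2
  have hu_deriv := (hu_slice.differentiable (by simp) x).hasDerivAt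
  have hux_deriv := (hux_slice.differentiable (by simp) x).hasDerivAt
  have hp1_deriv := ((contDiff_slice_left hp1 t).differentiable (by simp) x).hasDerivAt
  have hp2_deriv := ((contDiff_slice_left hp2 t).differentiable (by simp) x).hasDerivAt
  rw [hZSp1] at hp1_deriv
  rw [hZSp2] at hp2_deriv
  have hAf1_deriv := (((((hu_deriv.mul hu_deriv.star).const_mul I).add_const
    (2 * I * (ξ : ℂ) ^ 2)).mul hp1_deriv).add
    (((hux_deriv.star.const_mul I).neg.sub (hu_deriv.star.const_mul (2 * (ξ : ℂ)))).mul
      hp2_deriv)).congr_of_eventuallyEq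
    (Filter.Eventually.of_forall fun y => hAf1 y t)
  have hAf2_deriv := ((((hux_deriv.const_mul I).sub (hu_deriv.const_mul (2 * (ξ : ℂ)))).mul
    hp1_deriv).add
    ((((hu_deriv.mul hu_deriv.star).const_mul I).neg.sub_const
      (2 * I * (ξ : ℂ) ^ 2)).mul hp2_deriv)).congr_of_eventuallyEq
    (Filter.Eventually.of_forall fun y => hAf2 y t)
  have hNLS_at := hNLS x t
  have hNLS_conj := congrArg star hNLS_at
  simp only [star_def, map_mul, map_add, map_sub, map_neg, map_sum, conj_I, map_ofNat,
    RingHomCompTriple.comp_apply, RingHom.id_apply] at hNLS_at hNLS_conj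
  simp only [hLf1, hLf2, hZSp1, hZSp2, hAf1_deriv.deriv, hAf2_deriv.deriv,
    sigma_three_commutator_vecMulVec]
  rw [hAf1, hAf2]
  have hsource₁ : ∑ n, (2 * (f1 n x t * g2 n x t) +
      2 * ((starRingEnd ℂ) (f2 n x t) * (starRingEnd ℂ) (g1 n x t))) =
      2 * ∑ n, (f1 n x t * g2 n x t + (starRingEnd ℂ) (f2 n x t) * (starRingEnd ℂ) (g1 n x t)) := by
    simp only [Finset.mul_sum, mul_add]
  have hsource₂ : ∑ n, (-2 * (f2 n x t * g1 n x t) +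
      -2 * ((starRingEnd ℂ) (f1 n x t) * (starRingEnd ℂ) (g2 n x t))) =
      -2 * ∑ n, ((starRingEnd ℂ) (f1 n x t) * (starRingEnd ℂ) (g2 n x t) + f2 n x t * g1 n x t) := by
    rw [Finset.mul_sum]
    exact Finset.sum_congr rfl fun n _ => by ring
  have hI : I ^ 2 = -1 := I_sq
  ext j
  fin_cases j
  · simp only [Fin.zero_eta, Fin.isValue, Matrix.mulVec, dotProduct,
      Fin.sum_univ_two, Matrix.smul_apply, Matrix.sum_apply, Matrix.add_apply, of_apply,
      cons_val_zero, cons_val_one, cons_val', cons_val_fin_one, smul_eq_mul, add_zero,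
      Finset.sum_const_zero, mul_zero, zero_mul, zero_add, Pi.mul_apply,
      Pi.sub_apply, Pi.neg_apply, star_def, hsource₁]
    linear_combination p2 x t * hNLS_conj +
      p2 x t * (2 * u x t * (starRingEnd ℂ) (u x t) ^ 2 -
        (starRingEnd ℂ) (deriv (deriv fun y => u y t) x) -
        2 * I * ξ * (starRingEnd ℂ) (deriv (fun y => u y t) x)) * hI
  · simp only [Fin.mk_one, Fin.isValue, Matrix.mulVec, dotProduct,
      Fin.sum_univ_two, Matrix.smul_apply, Matrix.sum_apply, Matrix.add_apply, of_apply,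
      cons_val_zero, cons_val_one, cons_val', cons_val_fin_one, smul_eq_mul, add_zero,
      Finset.sum_const_zero, mul_zero, zero_mul, Pi.mul_apply,
      Pi.sub_apply, Pi.neg_apply, star_def, hsource₂]
    linear_combination p1 x t * hNLS_at +
      p1 x t * (2 * u x t ^ 2 * (starRingEnd ℂ) (u x t) -
        deriv (deriv fun y => u y t) x + 2 * I * ξ * deriv (fun y => u y t) x) * hI
end

section
/- Let u : ℝ → ℂ be continuous and ξₘ, ξₙ ∈ ℝ with ξₘ ≠ ξₙ. Suppose f = (f₁,f₂) : ℝ → ℂ² solves the Zakharov–Shabat system at ξₘ, G = (g₁,g₂) : ℝ → ℂ² solves the adjoint system at ξₙ, the function g₁f₁ + g₂f₂ is integrable on ℝ, the improper integrals φ(x) = ∫_{−∞}^{x} (g₁f₁ + g₂f₂) ds exist with φ(x) → ∫_{−∞}^{∞}(g₁f₁+g₂f₂)ds as x → ∞, and g₁(x)f₁(x) − g₂(x)f₂(x) → 0 as x → ±∞. Then ∫_{−∞}^{∞} (g₁(s)f₁(s) + g₂(s)f₂(s)) ds = 0. -/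
open Complex Filter MeasureTheory

/-- Orthogonality of eigenfunctions with distinct eigenvalues: if `f` solves the
Zakharov–Shabat system at `ξₘ`, `G` solves the adjoint system at `ξₙ ≠ ξₘ`,
`g₁f₁ + g₂f₂` is integrable with `∫_{-∞}^x → ∫_ℝ` as `x → ∞`, and
`g₁f₁ - g₂f₂ → 0` as `x → ±∞`, then `∫_ℝ (g₁f₁ + g₂f₂) = 0`. -/
theorem orthogonality_distinct_eigenvalues
    (u : ℝ → ℂ) (hu : Continuous u) (ξm ξn : ℝ) (hne : ξm ≠ ξn)
    (f1 f2 g1 g2 : ℝ → ℂ)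
    (hf1 : ∀ x, HasDerivAt f1 (-(Complex.I * (ξm : ℂ)) * f1 x + star (u x) * f2 x) x)
    (hf2 : ∀ x, HasDerivAt f2 (Complex.I * (ξm : ℂ) * f2 x + u x * f1 x) x)
    (hg1 : ∀ x, HasDerivAt g1 (Complex.I * (ξn : ℂ) * g1 x + u x * g2 x) x)
    (hg2 : ∀ x, HasDerivAt g2 (-(Complex.I * (ξn : ℂ)) * g2 x + star (u x) * g1 x) x)
    (hint : Integrable (fun s => g1 s * f1 s + g2 s * f2 s))
    (hφ : Tendsto (fun x => ∫ s in Set.Iic x, (g1 s * f1 s + g2 s * f2 s)) atTop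
      (nhds (∫ s, (g1 s * f1 s + g2 s * f2 s))))
    (hlim1 : Tendsto (fun x => g1 x * f1 x - g2 x * f2 x) atTop (nhds 0))
    (hlim2 : Tendsto (fun x => g1 x * f1 x - g2 x * f2 x) atBot (nhds 0)) :
    ∫ s, (g1 s * f1 s + g2 s * f2 s) = 0 := by
  have hderiv : ∀ x, HasDerivAt (fun x => g1 x * f1 x - g2 x * f2 x)
      (I * ((ξn : ℂ) - ξm) * (g1 x * f1 x + g2 x * f2 x)) x := fun x => by
    refine (((hg1 x).fun_mul (hf1 x)).fun_sub ((hg2 x).fun_mul (hf2 x))).congr_deriv ?_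
    ring
  have hzero := integral_of_hasDerivAt_of_tendsto hderiv
    (hint.const_mul (I * ((ξn : ℂ) - ξm))) hlim2 hlim1
  rw [integral_const_mul, sub_zero] at hzero
  have hξ : (ξn : ℂ) - ξm ≠ 0 := sub_ne_zero.mpr (ofReal_injective.ne hne.symm)
  exact (mul_eq_zero.mp hzero).resolve_left (mul_ne_zero I_ne_zero hξ)
end

section
/- Let ρ > ν > 0, ζ = √(ρ² − ν²), c > 0, and α₊, α₋ ∈ ℝ with e^{i(α₊ − α₋)} = (ζ − iν)/(ζ + iν). Let A₁ : ℝ → ℂ be continuous, g(t) = ∫₀ᵗ (A₁(τ) + A₁(τ)*) dτ, and let α₁ : ℝ → ℂ be continuous with α₁(t) ≠ 0 for all t. Define D(x,t) = e^{νx} + c e^{−νx + 4ζνt − g(t)}, u(x,t) = ρ e^{−2iρ²t}(e^{iα₊} e^{νx} + c e^{iα₋} e^{−νx + 4ζνt − g(t)})/D(x,t), F₁ = (f₁₁, f₂₁) with f₁₁(x,t) = α₁(t)·(−i(ζ−iν)/ρ)·e^{−iα₊ + 2iρ²t}/D(x,t) and f₂₁(x,t) = α₁(t)/D(x,t), and G₁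 = (g₁₁, g₂₁) with g₁₁(x,t) = (νA₁(t)/α₁(t))·(i(ζ−iν)/ρ)·e^{iα₋ − 2iρ²t}·c e^{4ζνt − g(t)}/D(x,t) and g₂₁(x,t) = (νA₁(t)/α₁(t))·c e^{4ζνt − g(t)}/D(x,t). Then u satisfies the defocusing NLS equation with self-consistent source: i u_t − 2u|u|² + u_xx = −2i(f₁₁* g₂₁* + f₂₁ g₁₁) for all (x,t) ∈ ℝ × ℝ. -/
open Complex

lemma hasDerivAt_cexp_real_affine (a b : ℂ) (x : ℝ) :
    HasDerivAt (fun y : ℝ => cexp (a * y + b)) (a * cexp (a * x + b)) x := by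
  have h : HasDerivAt (fun y : ℝ => a * (y : ℂ) + b) a x := by
    simpa using ((Complex.ofRealCLM.hasDerivAt (x := x)).const_mul a).add_const b
  simpa [mul_comm] using h.cexp

/-- The quotient `(a E + b P) / (E + P)` differentiates by the Wronskian of `E, P`. -/
lemma HasDerivAt.weighted_quotient {E P : ℝ → ℂ} {E' P' : ℂ} {x : ℝ} (a b : ℂ)
    (hE : HasDerivAt E E' x) (hP : HasDerivAt P P' x) (h : E x + P x ≠ 0) :
    HasDerivAt (fun y => (a * E y + b * P y) / (E y + P y))
      ((a - b) * (E' * P x - E x * P') / (E x + P x) ^ 2) x := by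
  convert ((hE.const_mul a).fun_add (hP.const_mul b)).fun_div (hE.fun_add hP) h using 1
  congr 1
  ring

/-- The integral of `A + star A` is real, with the expected derivative. -/
lemma hasDerivAt_integral_add_star {A : ℝ → ℂ} (hA : Continuous A) (t : ℝ) :
    HasDerivAt (fun s => ∫ τ in (0 : ℝ)..s, (A τ + star (A τ))) (A t + star (A t)) t :=
  (hA.add hA.star).integral_hasStrictDerivAt 0 t |>.hasDerivAt

lemma integral_add_star_eq_ofReal (A : ℝ → ℂ) (t : ℝ) :
    ∫ τ in (0 : ℝ)..t, (A τ + star (A τ)) = ((∫ τ in (0 : ℝ)..t, 2 * (A τ).re : ℝ) : ℂ) := by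
  rw [← intervalIntegral.integral_ofReal]
  refine intervalIntegral.integral_congr fun τ _ => ?_
  simpa using Complex.add_conj (A τ)

/-- The algebraic identity behind the one-soliton solution: `E, P` are the two exponentials,
`w` the background phase, `a, b` the asymptotic phases with `a (z + i n) = b (z - i n)`, and
`S, T` the source amplitude and its conjugate. -/
lemma soliton_with_source_identity {r n z a b a' b' w w' E P S T : ℂ} (hr : r ≠ 0)
    (hD : E + P ≠ 0) (hrz : r ^ 2 = z ^ 2 + n ^ 2) (ha : a * a' = 1) (hb : b * b' = 1)
    (hw : w * w' = 1) (hab : a * (z + I * n) = b * (z - I * n)) :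
    I * (-(2 * I * r ^ 2) * (r * w * ((a * E + b * P) / (E + P)))
        + r * w * ((a - b) * (-(E * ((4 * z * n - (S + T)) * P))) / (E + P) ^ 2))
      - 2 * (r * w * ((a * E + b * P) / (E + P))) *
        (r * w * ((a * E + b * P) / (E + P)) * (r * w' * ((a' * E + b' * P) / (E + P))))
      + r * w * (2 * n * (a - b) * (E * P) * (-(2 * n * (E - P))) / (E + P) ^ 3) =
    -2 * I * ((I * (z + I * n) / r * a * w * (n * T) * (E * P)) / (E + P) ^ 2
      + (I * (z - I * n) / r * b * w * (n * S) * (E * P)) / (E + P) ^ 2) := by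
  have hI : I ^ 2 = -1 := I_sq
  have hdiff : r ^ 2 * (a - b) = -(2 * I * n) * (a * (z + I * n)) := by
    linear_combination (a - b) * hrz + (z + I * n) * hab + (a - b) * n ^ 2 * hI
  have hcross : r ^ 2 * (a * b' + b * a') = 2 * r ^ 2 - 4 * n ^ 2 := by
    have hab' : b' * (z + I * n) = a' * (z - I * n) := by
      linear_combination (a' * b') * hab - (b' * (z + I * n)) * ha + (a' * (z - I * n)) * hb
    linear_combination (b' - a') * hdiff - (2 * I * n * a) * hab' - (2 * I * n) * (z - I * n) * ha
      + r ^ 2 * ha + r ^ 2 * hb + 2 * I * n * (z + I * n) * ha + 4 * n ^ 2 * hI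
  have hmod : r ^ 2 * ((a * E + b * P) * (a' * E + b' * P)) =
      r ^ 2 * (E + P) ^ 2 - 4 * n ^ 2 * (E * P) := by
    linear_combination (r ^ 2 * E ^ 2) * ha + (r ^ 2 * P ^ 2) * hb + (E * P) * hcross
  have hpoly : I * (-(2 * I * r ^ 2) * (r ^ 2 * w * (a * E + b * P) * (E + P) ^ 2)
        + r ^ 2 * w * (a - b) * (-(E * ((4 * z * n - (S + T)) * P))) * (E + P))
      - 2 * r ^ 4 * w ^ 2 * w' * (a * E + b * P) ^ 2 * (a' * E + b' * P)
      + r ^ 2 * w * (2 * n * (a - b) * (E * P) * (-(2 * n * (E - P)))) =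
      -2 * I * (I * (z + I * n) * a * w * (n * T) * (E * P)
        + I * (z - I * n) * b * w * (n * S) * (E * P)) * (E + P) := by
    linear_combination (-2 * r ^ 4 * w * (a * E + b * P) ^ 2 * (a' * E + b' * P)) * hw
      + (-2 * r ^ 2 * w * (a * E + b * P)) * hmod
      + (-2 * r ^ 4 * w * (a * E + b * P) * (E + P) ^ 2) * hI
      + (I * w * E * P * (S + T) * (E + P)) * hdiff
      + (-2 * I ^ 2 * n * w * E * P * (E + P) * S) * hab
      + (4 * n * r ^ 2 * w * E * P * (E + P)) * (-I * hab + n * (a + b) * hI)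
  field_simp
  linear_combination hpoly

/-- The explicit one-eigenvalue solution of the paper's Example satisfies the
defocusing NLS equation with self-consistent source of type (A):
`i u_t - 2u|u|² + u_xx = -2i(f₁₁* g₂₁* + f₂₁ g₁₁)`. -/
theorem example_solves_nls_with_source
    (ρ ν ζ c αp αm : ℝ) (hν : 0 < ν) (hρν : ν < ρ)
    (hζ : ζ = Real.sqrt (ρ ^ 2 - ν ^ 2)) (hc : 0 < c)
    (hphase : Complex.exp (Complex.I * ((αp : ℂ) - (αm : ℂ))) =
      ((ζ : ℂ) - Complex.I * ν) / ((ζ : ℂ) + Complex.I * ν))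
    (A₁ : ℝ → ℂ) (hA₁ : Continuous A₁)
    (g : ℝ → ℂ) (hg : ∀ t, g t = ∫ τ in (0 : ℝ)..t, (A₁ τ + star (A₁ τ)))
    (α₁ : ℝ → ℂ) (hα₁ : Continuous α₁) (hα₁0 : ∀ t, α₁ t ≠ 0)
    (D u f11 f21 g11 g21 : ℝ → ℝ → ℂ)
    (hD : ∀ x t, D x t = Complex.exp ((ν : ℂ) * x)
      + c * Complex.exp (-((ν : ℂ) * x) + 4 * (ζ : ℂ) * ν * t - g t))
    (hu : ∀ x t, u x t = ρ * Complex.exp (-(2 * Complex.I * (ρ : ℂ) ^ 2 * t)) *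
      (Complex.exp (Complex.I * αp) * Complex.exp ((ν : ℂ) * x)
        + c * Complex.exp (Complex.I * αm) *
            Complex.exp (-((ν : ℂ) * x) + 4 * (ζ : ℂ) * ν * t - g t)) / D x t)
    (hf11 : ∀ x t, f11 x t = α₁ t * (-(Complex.I * ((ζ : ℂ) - Complex.I * ν)) / ρ) *
      Complex.exp (-(Complex.I * αp) + 2 * Complex.I * (ρ : ℂ) ^ 2 * t) / D x t)
    (hf21 : ∀ x t, f21 x t = α₁ t / D x t)
    (hg11 : ∀ x t, g11 x t = ((ν : ℂ) * A₁ t / α₁ t) *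
      (Complex.I * ((ζ : ℂ) - Complex.I * ν) / ρ) *
      Complex.exp (Complex.I * αm - 2 * Complex.I * (ρ : ℂ) ^ 2 * t) *
      (c * Complex.exp (4 * (ζ : ℂ) * ν * t - g t)) / D x t)
    (hg21 : ∀ x t, g21 x t = ((ν : ℂ) * A₁ t / α₁ t) *
      (c * Complex.exp (4 * (ζ : ℂ) * ν * t - g t)) / D x t) :
    ∀ x t, Complex.I * deriv (fun s => u x s) t
        - 2 * u x t * (u x t * star (u x t))
        + deriv (fun y => deriv (fun z => u z t) y) x =
      -2 * Complex.I * (star (f11 x t) * star (g21 x t) + f21 x t * g11 x t) := by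
  intro x t
  subst hζ
  have hρ : 0 < ρ := hν.trans hρν
  set ζ := Real.sqrt (ρ ^ 2 - ν ^ 2) with hζ
  have hζsq : (ρ : ℂ) ^ 2 = (ζ : ℂ) ^ 2 + (ν : ℂ) ^ 2 := by
    have h : ζ ^ 2 = ρ ^ 2 - ν ^ 2 := Real.sq_sqrt (by nlinarith)
    exact_mod_cast (by linarith : ρ ^ 2 = ζ ^ 2 + ν ^ 2)
  obtain ⟨G, hG⟩ : ∃ G : ℝ → ℝ, ∀ t, g t = (G t : ℂ) :=
    ⟨_, fun t => (hg t).trans (integral_add_star_eq_ofReal A₁ t)⟩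
  have hgderiv : HasDerivAt g (A₁ t + star (A₁ t)) t := by
    rw [funext hg]
    exact hasDerivAt_integral_add_star hA₁ t
  have hsum : (ζ : ℂ) + I * ν ≠ 0 := by
    intro h
    have := congrArg Complex.im h
    simp at this
    exact hν.ne' this
  set a := cexp (I * αp) with ha
  set b := cexp (I * αm) with hb
  have hab : a * (ζ + I * ν) = b * (ζ - I * ν) := by
    have h : a = b * cexp (I * ((αp : ℂ) - αm)) := by
      rw [ha, hb, ← Complex.exp_add]
      ring_nf
    rw [h, hphase]
    field_simp
  let E : ℝ → ℂ := fun y => cexp ((ν : ℂ) * y)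
  let P : ℝ → ℝ → ℂ := fun y s => c * cexp (-((ν : ℂ) * y) + 4 * (ζ : ℂ) * ν * s - g s)
  let w : ℝ → ℂ := fun s => cexp (-(2 * I * (ρ : ℂ) ^ 2 * s))
  have hstarE (y : ℝ) : star (E y) = E y := by
    simp [E, ← Complex.exp_conj]
  have hstarP (y s : ℝ) : star (P y s) = P y s := by
    simp [P, hG, ← Complex.exp_conj, Complex.conj_ofNat]
  have hDpos (y s : ℝ) : E y + P y s ≠ 0 := by
    have h : E y + P y s = ((Real.exp (ν * y)
        + c * Real.exp (-(ν * y) + 4 * ζ * ν * s - G s) : ℝ) : ℂ) := by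
      simp [E, P, hG]
    rw [h]
    exact_mod_cast (by positivity : 0 < Real.exp (ν * y)
        + c * Real.exp (-(ν * y) + 4 * ζ * ν * s - G s)).ne'
  have hu' (y s : ℝ) : u y s = ρ * w s * ((a * E y + b * P y s) / (E y + P y s)) := by
    rw [hu, hD]
    simp only [E, P, w]
    ring
  have hE' (y : ℝ) : HasDerivAt E (ν * E y) y := by
    simpa [E] using hasDerivAt_cexp_real_affine (ν : ℂ) 0 y
  have hPx (y s : ℝ) : HasDerivAt (fun z => P z s) (-ν * P y s) y := by
    have h1 : HasDerivAt (fun z : ℝ => -((ν : ℂ) * z) + 4 * (ζ : ℂ) * ν * s - g s) (-ν : ℂ) y := by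
      simpa using ((((Complex.ofRealCLM.hasDerivAt (x := y)).const_mul
        (ν : ℂ)).fun_neg).add_const (4 * (ζ : ℂ) * ν * s)).sub_const (g s)
    refine (h1.cexp.const_mul (c : ℂ)).congr_deriv ?_
    simp only [P]
    ring
  have hPt : HasDerivAt (fun s => P x s) ((4 * ζ * ν - (A₁ t + star (A₁ t))) * P x t) t := by
    have h1 : HasDerivAt (fun s : ℝ => -((ν : ℂ) * x) + 4 * (ζ : ℂ) * ν * s - g s)
        (4 * ζ * ν - (A₁ t + star (A₁ t))) t := by
      simpa using (((Complex.ofRealCLM.hasDerivAt (x := t)).const_mul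
        (4 * (ζ : ℂ) * ν)).const_add (-((ν : ℂ) * x))).fun_sub hgderiv
    refine (h1.cexp.const_mul (c : ℂ)).congr_deriv ?_
    simp only [P]
    ring
  have hw' : HasDerivAt w (-(2 * I * (ρ : ℂ) ^ 2) * w t) t := by
    simpa [w] using hasDerivAt_cexp_real_affine (-(2 * I * (ρ : ℂ) ^ 2)) 0 t
  have hut : deriv (fun s => u x s) t =
      -(2 * I * (ρ : ℂ) ^ 2) * (ρ * w t * ((a * E x + b * P x t) / (E x + P x t)))
        + ρ * w t * ((a - b) * (-(E x * ((4 * ζ * ν - (A₁ t + star (A₁ t))) * P x t)))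
          / (E x + P x t) ^ 2) := by
    rw [funext (hu' x)]
    have h := (hw'.const_mul (ρ : ℂ)).fun_mul
      (HasDerivAt.weighted_quotient a b (hasDerivAt_const t (E x)) hPt (hDpos x t))
    rw [h.deriv]
    ring
  have hux (y : ℝ) : deriv (fun z => u z t) y =
      ρ * w t * (2 * ν * (a - b) * (E x * P x t) / (E y + P y t) ^ 2) := by
    rw [funext fun z => hu' z t]
    have h := (HasDerivAt.weighted_quotient a b (hE' y) (hPx y t) (hDpos y t)).const_mul
      ((ρ : ℂ) * w t)
    have hEP : E x * P x t = E y * P y t := by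
      simp only [E, P]
      rw [mul_left_comm, mul_left_comm (cexp (ν * y)), ← Complex.exp_add, ← Complex.exp_add]
      ring_nf
    rw [h.deriv, hEP]
    ring
  have huxx : deriv (fun y => deriv (fun z => u z t) y) x =
      ρ * w t * (2 * ν * (a - b) * (E x * P x t) * (-(2 * ν * (E x - P x t)))
        / (E x + P x t) ^ 3) := by
    rw [funext hux]
    have hD0 := hDpos x t
    have h := ((((hE' x).fun_add (hPx x t)).fun_pow 2).fun_inv (pow_ne_zero 2 hD0)).const_mul
      ((ρ : ℂ) * w t * (2 * ν * (a - b) * (E x * P x t)))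
    simp only [div_eq_mul_inv, ← mul_assoc] at h ⊢
    rw [h.deriv]
    field_simp
    ring
  have hstarw : star (w t) = cexp (2 * I * (ρ : ℂ) ^ 2 * t) := by
    simp [w, ← Complex.exp_conj, Complex.conj_ofNat]
  have hstara : star a = cexp (-(I * αp)) := by
    simp [ha, ← Complex.exp_conj]
  have hstarb : star b = cexp (-(I * αm)) := by
    simp [hb, ← Complex.exp_conj]
  have haa : a * star a = 1 := by
    rw [hstara, ha, ← Complex.exp_add]
    simp
  have hbb : b * star b = 1 := by
    rw [hstarb, hb, ← Complex.exp_add]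
    simp
  have hww : w t * star (w t) = 1 := by
    rw [hstarw, ← Complex.exp_add]
    simp
  have hstaru : star (u x t) =
      ρ * star (w t) * ((star a * E x + star b * P x t) / (E x + P x t)) := by
    rw [hu']
    simp only [star_mul', star_div₀, star_add, hstarE, hstarP]
    simp
  have hEP : E x * P x t = c * cexp (4 * (ζ : ℂ) * ν * t - g t) := by
    simp only [E, P]
    rw [mul_left_comm, ← Complex.exp_add]
    ring_nf
  have hDx : D x t = E x + P x t := hD x t
  have hα := hα₁0 t
  have hαs : star (α₁ t) ≠ 0 := star_ne_zero.mpr hα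
  have hρc : (ρ : ℂ) ≠ 0 := by exact_mod_cast hρ.ne'
  have hsource₁ : star (f11 x t) * star (g21 x t) =
      (I * (ζ + I * ν) / ρ * a * w t * (ν * star (A₁ t)) * (E x * P x t))
        / (E x + P x t) ^ 2 := by
    have hf : f11 x t = α₁ t * (-(I * ((ζ : ℂ) - I * ν)) / ρ) * (star a * star (w t))
        / (E x + P x t) := by
      rw [hf11, hDx, hstara, hstarw, ← Complex.exp_add]
    rw [hf, hg21, hDx, ← hEP]
    simp only [star_mul', star_div₀, star_add, star_sub, star_neg, star_star, hstarE, hstarP]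
    have hr (y : ℝ) : star (y : ℂ) = y := Complex.conj_ofReal y
    have hi : star I = -I := Complex.conj_I
    simp only [hr, hi]
    have hD0 := hDpos x t
    field_simp
    ring
  have hsource₂ : f21 x t * g11 x t =
      (I * (ζ - I * ν) / ρ * b * w t * (ν * A₁ t) * (E x * P x t))
        / (E x + P x t) ^ 2 := by
    have hexp : cexp (I * αm - 2 * I * (ρ : ℂ) ^ 2 * t) = b * w t := by
      rw [sub_eq_add_neg, Complex.exp_add]
    rw [hf21, hg11, hDx, ← hEP, hexp]
    have hD0 := hDpos x t
    field_simp
  rw [hut, huxx, hstaru, hu', hsource₁, hsource₂]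
  exact soliton_with_source_identity hρc (hDpos x t) hζsq haa hbb hww hab
end

section
/- Let ρ > ν > 0, ζ = √(ρ² − ν²), c > 0, and α₊, α₋ ∈ ℝ with e^{i(α₊ − α₋)} = (ζ − iν)/(ζ + iν). Let A₁ : ℝ → ℂ be continuous, g(t) = ∫₀ᵗ (A₁(τ) + A₁(τ)*) dτ, α₁ : ℝ → ℂ continuous with α₁(t) ≠ 0, D(x,t) = e^{νx} + c e^{−νx + 4ζνt − g(t)}, u(x,t) = ρ e^{−2iρ²t}(e^{iα₊} e^{νx} + c e^{iα₋} e^{−νx + 4ζνt − g(t)})/D(x,t), F₁ = (f₁₁, f₂₁) with f₁₁ = α₁(t)·(−i(ζ−iν)/ρ)·e^{−iα₊ + 2iρ²t}/D and f₂₁ = α₁(t)/D, and G₁ = (g₁₁, g₂₁) with g₁₁ = (νA₁(t)/α₁(t))·(i(ζ−iν)/ρ)·e^{iα₋ − 2iρ²t}·c e^{4ζνt − g(t)}/D and g₂₁ = (νA₁(t)/α₁(t))·c e^{4ζνt − g(t)}/D. Then for each t: (i) F₁(·,t) solves the Zakharov–Shabat system at ξ = ζ with potential u(·,t): ∂f₁₁/∂x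 = −iζ f₁₁ + u* f₂₁ and ∂f₂₁/∂x = iζ f₂₁ + u f₁₁; (ii) G₁(·,t) solves the adjoint system at ξ = ζ: ∂g₁₁/∂x = iζ g₁₁ + u g₂₁ and ∂g₂₁/∂x = −iζ g₂₁ + u* g₁₁; and (iii) ∫_{−∞}^{∞} (g₁₁(x,t) f₁₁(x,t) + g₂₁(x,t) f₂₁(x,t)) dx = A₁(t). -/
open Complex MeasureTheory

/-- The derivative of the reciprocal of `y ↦ exp (ν y) + k exp (-ν y)`, up to a constant factor. -/
theorem hasDerivAt_const_div_exp_add_exp_neg (ν : ℝ) {k : ℝ} (hk : 0 < k) (a : ℂ) (x : ℝ) :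
    HasDerivAt (fun y : ℝ => a / (Complex.exp ((ν : ℂ) * y) + k * Complex.exp (-((ν : ℂ) * y))))
      (-(a * (ν * (Complex.exp ((ν : ℂ) * x) - k * Complex.exp (-((ν : ℂ) * x)))))
        / (Complex.exp ((ν : ℂ) * x) + k * Complex.exp (-((ν : ℂ) * x))) ^ 2) x := by
  have hne : Complex.exp ((ν : ℂ) * x) + k * Complex.exp (-((ν : ℂ) * x)) ≠ 0 := by
    have h : (0 : ℝ) < Real.exp (ν * x) + k * Real.exp (-(ν * x)) := by positivity
    exact_mod_cast h.ne'
  have h1 : HasDerivAt (fun y : ℝ => (ν : ℂ) * y) ν x := by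
    simpa using (Complex.ofRealCLM.hasDerivAt (x := x)).const_mul (ν : ℂ)
  refine ((hasDerivAt_const x a).fun_div
    (h1.cexp.fun_add (h1.fun_neg.cexp.const_mul (k : ℂ))) hne).congr_deriv ?_
  ring

/-- The logistic density `2 ν k / (exp (ν x) + k exp (-ν x)) ^ 2` has total mass one. -/
theorem integral_logistic_density {ν k : ℝ} (hν : 0 < ν) (hk : 0 < k) :
    ∫ x : ℝ, 2 * ν * k / (Real.exp (ν * x) + k * Real.exp (-(ν * x))) ^ 2 = 1 := by
  have hder : ∀ x : ℝ, HasDerivAt (fun y : ℝ => (1 + k * Real.exp (-(2 * ν * y)))⁻¹)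
      (2 * ν * k / (Real.exp (ν * x) + k * Real.exp (-(ν * x))) ^ 2) x := by
    intro x
    have h1 : HasDerivAt (fun y : ℝ => -(2 * ν * y)) (-(2 * ν)) x := by
      simpa using ((hasDerivAt_id x).const_mul (2 * ν)).fun_neg
    have hne : 1 + k * Real.exp (-(2 * ν * x)) ≠ 0 := by positivity
    refine (((h1.exp.const_mul k).const_add 1).fun_inv hne).congr_deriv ?_
    have he : Real.exp (-(2 * ν * x)) = (Real.exp (ν * x))⁻¹ ^ 2 := by
      rw [← Real.exp_neg, ← Real.exp_nat_mul]; congr 1; push_cast; ring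
    have hpos := Real.exp_pos (ν * x)
    rw [he, Real.exp_neg]
    generalize Real.exp (ν * x) = E at hpos
    have : E ^ 2 + k ≠ 0 := by positivity
    field_simp
  have htop : Filter.Tendsto (fun y : ℝ => (1 + k * Real.exp (-(2 * ν * y)))⁻¹)
      Filter.atTop (nhds 1) := by
    have h : Filter.Tendsto (fun y : ℝ => -(2 * ν * y)) Filter.atTop Filter.atBot :=
      Filter.tendsto_neg_atTop_atBot.comp (Filter.tendsto_id.const_mul_atTop (by positivity))
    have h2 := (((Real.tendsto_exp_atBot.comp h).const_mul k).const_add 1).inv₀ (by simp)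
    simpa using h2
  have hbot : Filter.Tendsto (fun y : ℝ => (1 + k * Real.exp (-(2 * ν * y)))⁻¹)
      Filter.atBot (nhds 0) := by
    have h : Filter.Tendsto (fun y : ℝ => -(2 * ν * y)) Filter.atBot Filter.atTop :=
      Filter.tendsto_neg_atBot_atTop.comp (Filter.tendsto_id.const_mul_atBot (by positivity))
    exact Filter.Tendsto.inv_tendsto_atTop (Filter.tendsto_atTop_add_const_left _ _
      ((Real.tendsto_exp_atTop.comp h).const_mul_atTop hk))
  have hnn : ∀ x : ℝ, 0 ≤ 2 * ν * k / (Real.exp (ν * x) + k * Real.exp (-(ν * x))) ^ 2 :=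
    fun x => by positivity
  have hint : Integrable
      (fun x : ℝ => 2 * ν * k / (Real.exp (ν * x) + k * Real.exp (-(ν * x))) ^ 2) := by
    have hcont : Continuous
        (fun x : ℝ => 2 * ν * k / (Real.exp (ν * x) + k * Real.exp (-(ν * x))) ^ 2) :=
      Continuous.div (by fun_prop) (by fun_prop) (fun x => by positivity)
    refine integrable_of_intervalIntegral_norm_tendsto (1 - 0) (a := fun y : ℝ => -y)
      (b := fun y => y) (l := Filter.atTop)
      (fun y => (hcont.integrableOn_Icc).mono_set Set.Ioc_subset_Icc_self)
      Filter.tendsto_neg_atTop_atBot Filter.tendsto_id ?_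
    refine (htop.sub (hbot.comp Filter.tendsto_neg_atTop_atBot)).congr fun y => ?_
    simp only [Real.norm_of_nonneg (hnn _)]
    exact (intervalIntegral.integral_eq_sub_of_hasDerivAt (fun x _ => hder x)
      (hcont.intervalIntegrable _ _)).symm
  simpa using integral_of_hasDerivAt_of_tendsto hder hint hbot htop

/-- The explicit source functions of the paper's Example: (i) `F₁` solves the
Zakharov–Shabat system at `ξ = ζ` with potential `u(·,t)`, (ii) `G₁` solves the
adjoint system at `ξ = ζ`, and (iii) they obey the type (A) normalization
`∫ G₁ᵀF₁ dx = A₁(t)`. -/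
theorem example_source_functions
    (ρ ν ζ c αp αm : ℝ) (hν : 0 < ν) (hρν : ν < ρ)
    (hζ : ζ = Real.sqrt (ρ ^ 2 - ν ^ 2)) (hc : 0 < c)
    (hphase : Complex.exp (Complex.I * ((αp : ℂ) - (αm : ℂ))) =
      ((ζ : ℂ) - Complex.I * ν) / ((ζ : ℂ) + Complex.I * ν))
    (A₁ : ℝ → ℂ) (hA₁ : Continuous A₁)
    (g : ℝ → ℂ) (hg : ∀ t, g t = ∫ τ in (0 : ℝ)..t, (A₁ τ + star (A₁ τ)))
    (α₁ : ℝ → ℂ) (hα₁ : Continuous α₁) (hα₁0 : ∀ t, α₁ t ≠ 0)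
    (D u f11 f21 g11 g21 : ℝ → ℝ → ℂ)
    (hD : ∀ x t, D x t = Complex.exp ((ν : ℂ) * x)
      + c * Complex.exp (-((ν : ℂ) * x) + 4 * (ζ : ℂ) * ν * t - g t))
    (hu : ∀ x t, u x t = ρ * Complex.exp (-(2 * Complex.I * (ρ : ℂ) ^ 2 * t)) *
      (Complex.exp (Complex.I * αp) * Complex.exp ((ν : ℂ) * x)
        + c * Complex.exp (Complex.I * αm) *
            Complex.exp (-((ν : ℂ) * x) + 4 * (ζ : ℂ) * ν * t - g t)) / D x t)
    (hf11 : ∀ x t, f11 x t = α₁ t * (-(Complex.I * ((ζ : ℂ) - Complex.I * ν)) / ρ) *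
      Complex.exp (-(Complex.I * αp) + 2 * Complex.I * (ρ : ℂ) ^ 2 * t) / D x t)
    (hf21 : ∀ x t, f21 x t = α₁ t / D x t)
    (hg11 : ∀ x t, g11 x t = ((ν : ℂ) * A₁ t / α₁ t) *
      (Complex.I * ((ζ : ℂ) - Complex.I * ν) / ρ) *
      Complex.exp (Complex.I * αm - 2 * Complex.I * (ρ : ℂ) ^ 2 * t) *
      (c * Complex.exp (4 * (ζ : ℂ) * ν * t - g t)) / D x t)
    (hg21 : ∀ x t, g21 x t = ((ν : ℂ) * A₁ t / α₁ t) *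
      (c * Complex.exp (4 * (ζ : ℂ) * ν * t - g t)) / D x t) :
    -- (i) F₁(·,t) solves the Zakharov–Shabat system at ξ = ζ
    (∀ t x, HasDerivAt (fun y => f11 y t)
        (-(Complex.I * (ζ : ℂ)) * f11 x t + star (u x t) * f21 x t) x ∧
      HasDerivAt (fun y => f21 y t)
        (Complex.I * (ζ : ℂ) * f21 x t + u x t * f11 x t) x) ∧
    -- (ii) G₁(·,t) solves the adjoint system at ξ = ζ
    (∀ t x, HasDerivAt (fun y => g11 y t)
        (Complex.I * (ζ : ℂ) * g11 x t + u x t * g21 x t) x ∧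
      HasDerivAt (fun y => g21 y t)
        (-(Complex.I * (ζ : ℂ)) * g21 x t + star (u x t) * g11 x t) x) ∧
    -- (iii) the type (A) source normalization
    (∀ t, ∫ x : ℝ, (g11 x t * f11 x t + g21 x t * f21 x t) = A₁ t) := by
  have hρ : 0 < ρ := hν.trans hρν
  have hsq : (ρ : ℂ) ^ 2 = ζ ^ 2 + ν ^ 2 := by
    have h : ρ ^ 2 = ζ ^ 2 + ν ^ 2 := by
      rw [hζ, Real.sq_sqrt (by nlinarith)]; ring
    exact_mod_cast h
  have hρ0 : (ρ : ℂ) ≠ 0 := by exact_mod_cast hρ.ne'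
  have hprod : ((ζ : ℂ) - I * ν) * (ζ + I * ν) = ρ ^ 2 := by
    rw [hsq]; linear_combination (-(ν : ℂ) ^ 2) * I_sq
  have hp : (ζ : ℂ) + I * ν ≠ 0 := fun h => by
    rw [h, mul_zero] at hprod; exact pow_ne_zero 2 hρ0 hprod.symm
  -- the phase constraint, cleared of denominators
  have hPM : exp (I * αp) * (ζ + I * ν) = exp (I * αm) * (ζ - I * ν) := by
    rw [mul_sub, Complex.exp_sub, div_eq_div_iff (exp_ne_zero _) hp] at hphase
    linear_combination hphase
  have hgreal : ∀ t, ∃ r : ℝ, g t = r := fun t => by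
    refine ⟨∫ τ in (0 : ℝ)..t, 2 * (A₁ τ).re, ?_⟩
    rw [hg, ← intervalIntegral.integral_ofReal]
    congr 1; ext τ
    simpa using Complex.add_conj (A₁ τ)
  have hkey : ∀ t, ∃ k : ℝ, 0 < k ∧ c * exp (4 * (ζ : ℂ) * ν * t - g t) = k ∧
      ∀ x : ℝ, c * exp (-((ν : ℂ) * x) + 4 * (ζ : ℂ) * ν * t - g t) = k * exp (-((ν : ℂ) * x)) := by
    intro t
    obtain ⟨r, hr⟩ := hgreal t
    refine ⟨c * Real.exp (4 * ζ * ν * t - r), by positivity, by rw [hr]; push_cast; rfl, ?_⟩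
    intro x
    rw [hr, add_sub_assoc, Complex.exp_add]; push_cast; ring
  -- `β` is the constant part of the ratio of the two components of `F₁`
  set P := exp (I * αp) with hP
  set M := exp (I * αm) with hM
  have hP0 : P ≠ 0 := exp_ne_zero _
  have hM0 : M ≠ 0 := exp_ne_zero _
  have hstarP : star P = P⁻¹ := by
    rw [hP, ← Complex.exp_neg, Complex.star_def, ← Complex.exp_conj]; simp
  have hstarM : star M = M⁻¹ := by
    rw [hM, ← Complex.exp_neg, Complex.star_def, ← Complex.exp_conj]; simp
  obtain ⟨β, hβ⟩ : ∃ β : ℂ, β = -(I * ((ζ : ℂ) - I * ν)) / ρ := ⟨_, rfl⟩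
  have hρβ : ρ * β = -(I * (ζ - I * ν)) := by rw [hβ]; field_simp
  have hβp : ρ - I * ζ * β = -(ν * β) := by
    rw [hβ]; field_simp
    linear_combination hsq + (ζ ^ 2 + ν ^ 2 - I * ζ * ν) * I_sq
  have hρβM : ρ * β * M = -(I * (ζ + I * ν)) * P := by
    linear_combination M * hρβ + I * hPM
  have hβm : ρ * P - I * ζ * β * M = ν * β * M := by
    refine mul_left_cancel₀ hρ0 ?_
    linear_combination P * hsq - (I * ζ + ν) * hρβM + P * (ζ ^ 2 + ν ^ 2 + I * ζ * ν) * I_sq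
  have hββ : -(β ^ 2) * M = P := by
    refine mul_left_cancel₀ (pow_ne_zero 2 hρ0) ?_
    linear_combination (-(ρ * β)) * hρβM + I * (ζ + I * ν) * P * hρβ + P * hprod
      - P * (ζ - I * ν) * (ζ + I * ν) * I_sq
  have hmain : ∀ t, ∃ k : ℝ, ∃ T : ℂ, 0 < k ∧ T ≠ 0 ∧
      (∀ x, D x t = exp (ν * x) + k * exp (-(ν * x))) ∧
      (∀ x, u x t = ρ * T * (P * exp (ν * x) + k * M * exp (-(ν * x))) / D x t) ∧
      (∀ x, star (u x t) =
        ρ * T⁻¹ * (P⁻¹ * exp (ν * x) + k * M⁻¹ * exp (-(ν * x))) / D x t) ∧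
      (∀ x, f11 x t = α₁ t * β * P⁻¹ * T⁻¹ / D x t) ∧
      (∀ x, g11 x t = -(ν * A₁ t / α₁ t * β * M * T * k) / D x t) ∧
      (∀ x, g21 x t = (ν * A₁ t / α₁ t * k) / D x t) := by
    intro t
    obtain ⟨k, hk, hkg, hkx⟩ := hkey t
    have hD' : ∀ x, D x t = exp (ν * x) + k * exp (-(ν * x)) := fun x => by rw [hD, hkx]
    have hu' : ∀ x, u x t = ρ * exp (-(2 * I * (ρ : ℂ) ^ 2 * t)) *
        (P * exp (ν * x) + k * M * exp (-(ν * x))) / D x t := fun x => by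
      rw [hu, mul_right_comm (c : ℂ) M, hkx]; ring
    have hT : exp (2 * I * (ρ : ℂ) ^ 2 * t) = (exp (-(2 * I * (ρ : ℂ) ^ 2 * t)))⁻¹ := by
      rw [Complex.exp_neg, inv_inv]
    refine ⟨k, _, hk, exp_ne_zero (-(2 * I * (ρ : ℂ) ^ 2 * t)), hD', hu', fun x => ?_,
      fun x => ?_, fun x => ?_, fun x => by rw [hg21, hkg]⟩
    · have hstarT : star (exp (-(2 * I * (ρ : ℂ) ^ 2 * t))) =
          (exp (-(2 * I * (ρ : ℂ) ^ 2 * t)))⁻¹ := by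
        rw [← hT, Complex.star_def, ← Complex.exp_conj]; simp [Complex.conj_ofNat]
      have hstarE : ∀ y : ℝ, star (exp (y : ℂ)) = exp y := fun y => by
        rw [Complex.star_def, ← Complex.exp_conj, Complex.conj_ofReal]
      have h1 := hstarE (ν * x)
      have h2 := hstarE (-(ν * x))
      push_cast at h1 h2
      have hr : ∀ y : ℝ, star (y : ℂ) = y := Complex.conj_ofReal
      rw [hu', hD']
      simp only [star_div₀, star_mul', star_add, hstarT, hstarP, hstarM, h1, h2, hr]
    · rw [hf11, Complex.exp_add, Complex.exp_neg, hT, hβ]; ring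
    · rw [hg11, hkg, sub_eq_add_neg (I * (αm : ℂ)), Complex.exp_add, hβ]; ring
  have hDne : ∀ x t, D x t ≠ 0 := fun x t => by
    obtain ⟨k, T, hk, -, hD', -⟩ := hmain t
    have h : (0 : ℝ) < Real.exp (ν * x) + k * Real.exp (-(ν * x)) := by positivity
    rw [hD']
    exact_mod_cast h.ne'
  refine ⟨fun t x => ?_, fun t x => ?_, fun t => ?_⟩
  · obtain ⟨k, T, hk, hT, hD', hu', hsu, hf, -, -⟩ := hmain t
    have hd := fun a : ℂ => hasDerivAt_const_div_exp_add_exp_neg ν hk a x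
    simp only [← hD'] at hd
    have hx := hDne x t
    have hDx := hD' x
    constructor
    · rw [funext hf, hf, hf21, hsu]
      convert hd _ using 1
      generalize exp (ν * x) = E at *
      generalize exp (-(ν * x)) = N at *
      field_simp
      rw [hDx]
      linear_combination α₁ t * (E * M * hβp + k * N * hβm)
    · rw [funext (hf21 · t), hf21, hf, hu']
      convert hd _ using 1
      generalize exp (ν * x) = E at *
      generalize exp (-(ν * x)) = N at *
      field_simp
      rw [hDx]
      linear_combination α₁ t * (E * P * hρβ + k * N * hρβM + ν * P * (E - k * N) * I_sq)
  · obtain ⟨k, T, hk, hT, hD', hu', hsu, -, hg', hg''⟩ := hmain t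
    have hd := fun a : ℂ => hasDerivAt_const_div_exp_add_exp_neg ν hk a x
    simp only [← hD'] at hd
    have hx := hDne x t
    have hDx := hD' x
    have hα := hα₁0 t
    constructor
    · rw [funext hg', hg', hg'', hu']
      convert hd _ using 1
      generalize exp (ν * x) = E at *
      generalize exp (-(ν * x)) = N at *
      field_simp
      rw [hDx]
      linear_combination ν * A₁ t * k * (E * hβm + k * N * M * hβp)
    · rw [funext hg'', hg'', hg', hsu]
      convert hd _ using 1
      generalize exp (ν * x) = E at *
      generalize exp (-(ν * x)) = N at *
      field_simp
      rw [hDx]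
      linear_combination
        -ν * A₁ t * k * (E * hρβM + k * N * P * hρβ - ν * P * (E - k * N) * I_sq)
  · obtain ⟨k, T, hk, hT, hD', -, -, hf, hg', hg''⟩ := hmain t
    have hα := hα₁0 t
    have heq : ∀ x : ℝ, g11 x t * f11 x t + g21 x t * f21 x t =
        A₁ t * ((2 * ν * k / (Real.exp (ν * x) + k * Real.exp (-(ν * x))) ^ 2 : ℝ) : ℂ) := by
      intro x
      have hx := hDne x t
      have hDx := hD' x
      push_cast
      rw [hg', hf, hg'', hf21, ← hDx]
      field_simp
      linear_combination ν * A₁ t * k * hββ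
    simp only [heq]
    rw [integral_const_mul, integral_complex_ofReal, integral_logistic_density hν hk, ofReal_one, mul_one]
end
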